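/- Near-cancellation of the two coefficients in the duplication equation (Lemma A.9). Under the random features setup and the data, activation, and scaling assumptions with n = 2: there exist constants c, C, ε₀ > 0 and D such that for all d ≥ D, with probability at least 1 − 2 exp(−c log² d) over V and the data (x_1, x_2), the following holds simultaneously for all real numbers a_1, a_2 and all ε_1, ε_2 ∈ ℝ^d satisfying ‖x_1 + ε_1‖_2 = ‖x_1 + ε_2‖_2 = √d, max(‖ε_1‖_2, ‖ε_2‖_2) ≤ ε₀ √d, and φ(x_2) = a_1 φ(x_1 + ε_1) + a_2 φ(x_1 + ε_2): | a_1 + a_2 | ≤ C ( |a_2| δ + log d / √d ), where δ := ‖ε_2 − ε_1‖_2 / √d. -/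

import Mathlib

open MeasureTheory ProbabilityTheory Filter

noncomputable section

/-- Euclidean (ℓ²) norm of a vector in `Fin m → ℝ`. -/
def eNorm {m : ℕ} (x : Fin m → ℝ) : ℝ := Real.sqrt (∑ j, (x j) ^ 2)

/-- Euclidean dot product. -/
def dotp {m : ℕ} (u v : Fin m → ℝ) : ℝ := ∑ j, u j * v j

/-- The random-features map `x ↦ (φ(vₖᵀx))ₖ`, where `vₖ` is the `k`-th row of `V`. -/
def featureMap {p d : ℕ} (φ : ℝ → ℝ) (V : Fin p → Fin d → ℝ) (x : Fin d → ℝ) :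
    Fin p → ℝ := fun k => φ (dotp (V k) x)

/-- The `l`-th normalized probabilists' Hermite polynomial (orthonormal in `L²(N(0,1))`). -/
def hermiteFn (l : ℕ) (x : ℝ) : ℝ :=
  (Polynomial.aeval x (Polynomial.hermite l)) / Real.sqrt (Nat.factorial l)

/-- The `l`-th Hermite coefficient `μ_l` of `φ`. -/
def hermiteCoeff (φ : ℝ → ℝ) (l : ℕ) : ℝ :=
  ∫ g, φ g * hermiteFn l g ∂(gaussianReal 0 1)

/-- The nonlinear part of the feature map: `φ̃(x) = (φ(vₖᵀx) − μ₁ vₖᵀx)ₖ`. -/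
def tfeatureMap {p d : ℕ} (φ : ℝ → ℝ) (V : Fin p → Fin d → ℝ) (x : Fin d → ℝ) :
    Fin p → ℝ := fun k => φ (dotp (V k) x) - hermiteCoeff φ 1 * dotp (V k) x

/-- `μ̃² := Σ_{l ≥ 3} μ_l²`. -/
def tmu2 (φ : ℝ → ℝ) : ℝ := ∑' l : ℕ, if 3 ≤ l then (hermiteCoeff φ l) ^ 2 else 0

/-- The law of the random features matrix: i.i.d. entries `N(0, 1/d)`. -/
def gaussianMatrix (p d : ℕ) : Measure (Fin p → Fin d → ℝ) :=
  Measure.pi fun _ => Measure.pi fun _ => gaussianReal 0 ((d : NNReal))⁻¹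

/-- Sub-Gaussian norm of a distribution on `ℝ^d`:
`sup_{‖u‖₂ = 1} inf { t > 0 : E exp((uᵀx)²/t²) ≤ 2 }`. -/
def vecSubGNorm {d : ℕ} (P : Measure (Fin d → ℝ)) : ℝ :=
  ⨆ u : {u : Fin d → ℝ // eNorm u = 1},
    sInf {t : ℝ | 0 < t ∧ ∫ x, Real.exp ((dotp u.1 x) ^ 2 / t ^ 2) ∂P ≤ 2}

/-- Data assumption: `P` is a probability distribution on `ℝ^d` with `‖x‖₂ = √d` a.s.
and sub-Gaussian norm at most `K`. -/
structure DataAssumption {d : ℕ} (P : Measure (Fin d → ℝ)) (K : ℝ) : Prop where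
  prob : IsProbabilityMeasure P
  norm_eq : ∀ᵐ x ∂P, eNorm x = Real.sqrt d
  subg : vecSubGNorm P ≤ K

/-- Core activation assumption: `φ` is non-linear, Lipschitz, with Lipschitz derivative,
`μ₀ = μ₂ = 0` and `μ₁ ≠ 0`. -/
structure ActivationAssumptionCore (φ : ℝ → ℝ) : Prop where
  nonlinear : ¬ ∃ a b : ℝ, ∀ z, φ z = a * z + b
  lipschitz : ∃ L : NNReal, LipschitzWith L φ
  differentiable : Differentiable ℝ φ
  deriv_lipschitz : ∃ L' : NNReal, LipschitzWith L' (deriv φ)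
  mu0 : hermiteCoeff φ 0 = 0
  mu2 : hermiteCoeff φ 2 = 0
  mu1 : hermiteCoeff φ 1 ≠ 0

/-- Full activation assumption: additionally, there are two non-zero Hermite coefficients
of order ≥ 3 with different parity. -/
structure ActivationAssumption (φ : ℝ → ℝ) extends ActivationAssumptionCore φ : Prop where
  parity : ∃ l l' : ℕ, 3 ≤ l ∧ 3 ≤ l' ∧ l % 2 ≠ l' % 2 ∧
    hermiteCoeff φ l ≠ 0 ∧ hermiteCoeff φ l' ≠ 0

/-- Law of one row. -/
def gv (d : ℕ) : Measure (Fin d → ℝ) :=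
  Measure.pi fun _ => gaussianReal 0 ((d : NNReal))⁻¹

instance gv_prob (d : ℕ) : IsProbabilityMeasure (gv d) := by
  unfold gv; infer_instance

lemma gv_gauss (d : ℕ) : HasGaussianLaw (fun v : Fin d → ℝ => (fun i => v i)) (gv d) := by
  have h : iIndepFun (fun (i : Fin d) (v : Fin d → ℝ) => id (v i)) (gv d) :=
    iIndepFun_pi (X := fun _ ↦ id) (fun _ ↦ aemeasurable_id)
  refine iIndepFun.hasGaussianLaw (fun i => ?_) h
  have hm : (gv d).map (fun v => id (v i)) = gaussianReal 0 ((d : NNReal))⁻¹ :=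
    (measurePreserving_eval (fun _ : Fin d => gaussianReal 0 ((d : NNReal))⁻¹) i).map_eq
  constructor
  simp only [id] at hm
  rw [hm]; infer_instance

/-- dot product as a continuous linear map -/
def dotL {d : ℕ} (x : Fin d → ℝ) : (Fin d → ℝ) →L[ℝ] ℝ :=
  ∑ j, (x j) • (ContinuousLinearMap.proj j : (Fin d → ℝ) →L[ℝ] ℝ)

lemma dotL_apply {d : ℕ} (x v : Fin d → ℝ) : dotL x v = dotp v x := by
  simp [dotL, dotp, mul_comm]

lemma dot_pair {d : ℕ} (x y : Fin d → ℝ) :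
    HasGaussianLaw (fun v => (dotp v x, dotp v y)) (gv d) := by
  have := (gv_gauss d).map_fun ((dotL x).prod (dotL y))
  simpa [dotL_apply] using this

lemma coord_memLp {d : ℕ} (i : Fin d) : MemLp (fun v : Fin d → ℝ => v i) 2 (gv d) :=
  ((gv_gauss d).eval i).memLp_two

lemma map_coord {d : ℕ} (i : Fin d) :
    (gv d).map (fun v => v i) = gaussianReal 0 ((d : NNReal))⁻¹ :=
  (measurePreserving_eval (fun _ : Fin d => gaussianReal 0 ((d : NNReal))⁻¹) i).map_eq

lemma integral_coord {d : ℕ} (i : Fin d) : ∫ v, v i ∂(gv d) = 0 := by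
  have h := integral_map (μ := gv d) (φ := fun v : Fin d → ℝ => v i) (f := fun z : ℝ => z)
    (measurable_pi_apply i).aemeasurable (by fun_prop)
  rw [← h, map_coord, integral_id_gaussianReal]

lemma cov_coord {d : ℕ} (i j : Fin d) :
    cov[fun v => v i, fun v => v j; gv d] = if i = j then (d : ℝ)⁻¹ else 0 := by
  split_ifs with h
  · subst h
    rw [covariance_self (measurable_pi_apply i).aemeasurable]
    have h := variance_map (μ := gv d) (X := fun z : ℝ => z) (Y := fun v : Fin d → ℝ => v i)
      (by fun_prop) (measurable_pi_apply i).aemeasurable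
    rw [map_coord, variance_fun_id_gaussianReal] at h
    simpa [Function.comp_def] using h.symm
  · have h' : iIndepFun (fun (i : Fin d) (v : Fin d → ℝ) => id (v i)) (gv d) :=
      iIndepFun_pi (X := fun _ ↦ id) (fun _ ↦ aemeasurable_id)
    exact (h'.indepFun h).covariance_eq_zero (coord_memLp i) (coord_memLp j)

lemma cov_dot {d : ℕ} (x y : Fin d → ℝ) :
    cov[fun v => dotp v x, fun v => dotp v y; gv d] = dotp x y * (d : ℝ)⁻¹ := by
  unfold dotp
  rw [covariance_fun_sum_fun_sum (fun i => (coord_memLp i).mul_const _)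
    (fun i => (coord_memLp i).mul_const _)]
  simp_rw [covariance_mul_const_left, covariance_mul_const_right, cov_coord]
  simp [Finset.sum_mul]
  refine Finset.sum_congr rfl fun i _ => by ring

lemma integral_dot {d : ℕ} (x : Fin d → ℝ) : ∫ v, dotp v x ∂(gv d) = 0 := by
  unfold dotp
  rw [integral_finsetSum]
  · simp [integral_mul_const, integral_coord]
  · intro i _
    exact ((coord_memLp i).integrable (by norm_num)).mul_const _

lemma map_dot {d : ℕ} (x : Fin d → ℝ) :
    (gv d).map (fun v => dotp v x) = gaussianReal 0 (dotp x x * (d : ℝ)⁻¹).toNNReal := by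
  rw [(dot_pair x x).fst.map_eq_gaussianReal, integral_dot, ← covariance_self, cov_dot]
  exact (dot_pair x x).fst.aemeasurable

@[fun_prop]
lemma meas_dot {d : ℕ} (x : Fin d → ℝ) : Measurable (fun v : Fin d → ℝ => dotp v x) := by
  unfold dotp; fun_prop

/-- The Gaussian square-exponential constant. -/
def MG : ENNReal := ∫⁻ g, ENNReal.ofReal (Real.exp (g ^ 2 / 4)) ∂(gaussianReal 0 1)

lemma MG_lt : MG < ⊤ := by
  have : Integrable (fun g : ℝ => Real.exp (g ^ 2 / 4)) (gaussianReal 0 1) := by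
    rw [gaussianReal_of_var_ne_zero _ one_ne_zero,
      integrable_withDensity_iff (measurable_gaussianPDF 0 1) (by simp [gaussianPDF])]
    have h := (integrable_exp_neg_mul_sq (b := 1/4) (by norm_num)).mul_const
      (Real.sqrt (2 * Real.pi))⁻¹
    refine h.congr (Eventually.of_forall fun g => ?_)
    simp only [gaussianPDF, gaussianPDFReal]
    rw [ENNReal.toReal_ofReal (by positivity)]
    simp only [NNReal.coe_one, mul_one, sub_zero]
    rw [mul_comm (Real.sqrt _)⁻¹, ← mul_assoc, ← Real.exp_add]
    congr 2; ring
  exact this.lintegral_lt_top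

lemma MG_ge : 1 ≤ MG := by
  calc (1 : ENNReal) = ∫⁻ g, 1 ∂(gaussianReal 0 1) := by simp
    _ ≤ MG := by
      refine lintegral_mono fun g => ?_
      rw [← ENNReal.ofReal_one]
      exact ENNReal.ofReal_le_ofReal (Real.one_le_exp (by positivity))

lemma lint_dot {d : ℕ} (hd : 0 < d) (x : Fin d → ℝ) (s r : ℝ) (hx : dotp x x = r ^ 2 * d)
    (hs : s * r ^ 2 ≤ 1/4) :
    ∫⁻ v, ENNReal.ofReal (Real.exp (s * (dotp v x) ^ 2)) ∂(gv d) ≤ MG := by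
  have hd' : (d : ℝ) ≠ 0 := by positivity
  have h1 : (gv d).map (fun v => dotp v x) = (gaussianReal 0 1).map (fun z => r * z) := by
    rw [map_dot, gaussianReal_map_const_mul, hx]
    congr 1
    · simp
    · rw [mul_assoc, mul_inv_cancel₀ hd', mul_one, mul_one, Real.toNNReal_of_nonneg (by positivity)]
  rw [← lintegral_map (μ := gv d) (f := fun z : ℝ => ENNReal.ofReal (Real.exp (s * z ^ 2)))
    (g := fun v => dotp v x) (by fun_prop) (by fun_prop), h1,
    lintegral_map (by fun_prop) (by fun_prop)]
  refine lintegral_mono fun g => ENNReal.ofReal_le_ofReal (Real.exp_le_exp.2 ?_)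
  nlinarith [sq_nonneg g]

lemma dotp_sub_smul {d : ℕ} (v x y : Fin d → ℝ) (r : ℝ) :
    dotp v (x - r • y) = dotp v x - r * dotp v y := by
  simp only [dotp, Pi.sub_apply, Pi.smul_apply, smul_eq_mul, Finset.mul_sum,
    ← Finset.sum_sub_distrib]
  exact Finset.sum_congr rfl fun i _ => by ring

lemma dotp_comm {d : ℕ} (x y : Fin d → ℝ) : dotp x y = dotp y x := by
  simp [dotp, mul_comm]

lemma dot_memLp {d : ℕ} (x : Fin d → ℝ) : MemLp (fun v => dotp v x) 2 (gv d) :=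
  (dot_pair x x).fst.memLp_two

lemma lip_bound {φ : ℝ → ℝ} {L : NNReal} (hL : LipschitzWith L φ) (z : ℝ) :
    |φ z| ≤ |φ 0| + L * |z| := by
  have h := hL.dist_le_mul z 0
  rw [Real.dist_eq, Real.dist_eq, sub_zero] at h
  have := abs_sub_abs_le_abs_sub (φ z) (φ 0)
  linarith

lemma phi_memLp {φ : ℝ → ℝ} {L : NNReal} (hL : LipschitzWith L φ) {d : ℕ} (x : Fin d → ℝ) :
    MemLp (fun v => φ (dotp v x)) 2 (gv d) := by
  have h1 : MemLp (fun v => ‖dotp v x‖) 2 (gv d) := (dot_memLp x).norm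
  have h2 : MemLp (fun v => (L : ℝ) * ‖dotp v x‖) 2 (gv d) := h1.const_mul _
  have h3 : MemLp (fun _ : Fin d → ℝ => |φ 0|) 2 (gv d) := memLp_const _
  have h : MemLp (fun v => |φ 0| + (L : ℝ) * ‖dotp v x‖) 2 (gv d) := h3.add h2
  refine h.mono ((hL.continuous.measurable.comp (meas_dot x)).aestronglyMeasurable) ?_
  refine Eventually.of_forall fun v => ?_
  simp only [Real.norm_eq_abs]
  rw [abs_of_nonneg (a := |φ 0| + (L : ℝ) * |dotp v x|) (by positivity)]
  exact lip_bound hL _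

lemma map_dot_one {d : ℕ} (hd : 0 < d) {x : Fin d → ℝ} (hx : dotp x x = d) :
    (gv d).map (fun v => dotp v x) = gaussianReal 0 1 := by
  have hd' : (d : ℝ) ≠ 0 := by positivity
  rw [map_dot, hx, mul_inv_cancel₀ hd', Real.toNNReal_one]

lemma mean_xy {φ : ℝ → ℝ} {L : NNReal} (hL : LipschitzWith L φ) {d : ℕ} (hd : 0 < d)
    {x y : Fin d → ℝ} (hy : dotp y y = d) :
    ∫ v, dotp v x * φ (dotp v y) ∂(gv d) = hermiteCoeff φ 1 * (dotp x y / d) := by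
  have hd' : (d : ℝ) ≠ 0 := by positivity
  set ρ := dotp x y / d with hρ
  set z := x - ρ • y with hz
  have hcov : cov[fun v => dotp v z, fun v => dotp v y; gv d] = 0 := by
    rw [cov_dot, dotp_comm, hz, dotp_sub_smul, hy, hρ, dotp_comm y x]
    field_simp; ring
  have hind := (dot_pair z y).indepFun_of_covariance_eq_zero hcov
  have hind2 : IndepFun (fun v => dotp v z) (fun v => φ (dotp v y)) (gv d) :=
    hind.comp measurable_id hL.continuous.measurable
  have h0 : ∫ v, dotp v z * φ (dotp v y) ∂(gv d) = 0 := by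
    rw [hind2.integral_fun_mul_eq_mul_integral (meas_dot z).aestronglyMeasurable
      (phi_memLp hL y).aestronglyMeasurable, integral_dot, zero_mul]
  have h1 : ∫ v, dotp v y * φ (dotp v y) ∂(gv d) = hermiteCoeff φ 1 := by
    have hm := integral_map (μ := gv d) (φ := fun v => dotp v y) (f := fun z : ℝ => z * φ z)
      (by fun_prop) (by have := hL.continuous; fun_prop)
    rw [← hm, map_dot_one hd hy]
    unfold hermiteCoeff hermiteFn
    simp [mul_comm]
  have i1 : Integrable (fun v => dotp v y * φ (dotp v y)) (gv d) :=
    (dot_memLp y).integrable_mul (phi_memLp hL y)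
  have i2 : Integrable (fun v => dotp v z * φ (dotp v y)) (gv d) :=
    (dot_memLp z).integrable_mul (phi_memLp hL y)
  have : (fun v => dotp v x * φ (dotp v y)) =
      fun v => ρ * (dotp v y * φ (dotp v y)) + dotp v z * φ (dotp v y) := by
    funext v
    rw [hz, dotp_sub_smul]; ring
  rw [this, integral_add (i1.const_mul _) i2, integral_const_mul, h0, h1]
  ring

lemma exp_quad (y : ℝ) : Real.exp y ≤ 1 + y + y ^ 2 * Real.exp |y| := by
  have h := Complex.norm_exp_sub_sum_le_norm_mul_exp (y : ℂ) 2
  simp only [Finset.sum_range_succ, Finset.sum_range_zero] at h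
  have h2 : Complex.exp y - (0 + (y : ℂ) ^ 0 / (Nat.factorial 0 : ℂ) + (y : ℂ) ^ 1 / (Nat.factorial 1 : ℂ))
      = ((Real.exp y - (1 + y) : ℝ) : ℂ) := by
    push_cast; simp
  rw [h2, Complex.norm_real, Complex.norm_real, Real.norm_eq_abs, Real.norm_eq_abs, sq_abs] at h
  linarith [le_abs_self (Real.exp y - (1 + y))]

lemma exp_dom {a s0 s y : ℝ} (hs0 : 0 < s0) (hs : |s| ≤ s0) (hy : 2 * s0 * |y| ≤ a) :
    Real.exp (s * y) ≤ 1 + s * y + s ^ 2 * ((2 / s0 ^ 2) * Real.exp a) := by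
  have h1 := exp_quad (s * y)
  have h2 : |s * y| ≤ s0 * |y| := by
    rw [abs_mul]; exact mul_le_mul_of_nonneg_right hs (abs_nonneg _)
  have h3 := Real.quadratic_le_exp_of_nonneg (x := s0 * |y|) (by positivity)
  have h4 : y ^ 2 ≤ (2 / s0 ^ 2) * Real.exp (s0 * |y|) := by
    have : s0 ^ 2 * y ^ 2 ≤ 2 * Real.exp (s0 * |y|) := by
      rw [← sq_abs y]
      have : 0 ≤ s0 * |y| := by positivity
      nlinarith
    rw [div_mul_eq_mul_div, le_div_iff₀ (by positivity)]
    linarith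
  have h5 : y ^ 2 * Real.exp |s * y| ≤ (2 / s0 ^ 2) * Real.exp a := by
    calc y ^ 2 * Real.exp |s * y| ≤ ((2 / s0 ^ 2) * Real.exp (s0 * |y|)) * Real.exp (s0 * |y|) := by
          gcongr
      _ = (2 / s0 ^ 2) * Real.exp (2 * s0 * |y|) := by
          rw [mul_assoc, ← Real.exp_add]; ring_nf
      _ ≤ _ := by gcongr
  have : (s * y) ^ 2 * Real.exp |s * y| = s ^ 2 * (y ^ 2 * Real.exp |s * y|) := by ring
  rw [this] at h1
  have := mul_le_mul_of_nonneg_left h5 (sq_nonneg s)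
  linarith

lemma exp_split (a b : ℝ) : Real.exp (1/8 + (a + b) / 8) ≤
    Real.exp (1/8) * (Real.exp (a / 4) + Real.exp (b / 4)) := by
  rw [Real.exp_add]
  refine mul_le_mul_of_nonneg_left ?_ (Real.exp_pos _).le
  have h1 : Real.exp ((a + b) / 8) = Real.exp (a / 8) * Real.exp (b / 8) := by
    rw [← Real.exp_add]; ring_nf
  have h2 : Real.exp (a / 4) = Real.exp (a / 8) ^ 2 := by
    rw [← Real.exp_nat_mul]; push_cast; ring_nf
  have h3 : Real.exp (b / 4) = Real.exp (b / 8) ^ 2 := by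
    rw [← Real.exp_nat_mul]; push_cast; ring_nf
  rw [h1, h2, h3]
  nlinarith [sq_nonneg (Real.exp (a / 8) - Real.exp (b / 8)), Real.exp_pos (a/8), Real.exp_pos (b/8)]

lemma int_sqexp {d : ℕ} (hd : 0 < d) {x : Fin d → ℝ} (hx : dotp x x = d) :
    Integrable (fun v => Real.exp ((dotp v x) ^ 2 / 4)) (gv d) ∧
    ∫ v, Real.exp ((dotp v x) ^ 2 / 4) ∂(gv d) ≤ MG.toReal := by
  have h := lint_dot hd x (1/4) 1 (by simpa using hx) (by norm_num)
  have e : ∀ v, (1:ℝ)/4 * (dotp v x)^2 = (dotp v x) ^ 2 / 4 := fun v => by ring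
  simp_rw [e] at h
  have hm : AEStronglyMeasurable (fun v => Real.exp ((dotp v x) ^ 2 / 4)) (gv d) := by
    exact Measurable.aestronglyMeasurable (by fun_prop)
  refine ⟨⟨hm, ?_⟩, ?_⟩
  · rw [hasFiniteIntegral_iff_ofReal (Eventually.of_forall fun v => (Real.exp_pos _).le)]
    exact h.trans_lt MG_lt
  · rw [integral_eq_lintegral_of_nonneg_ae (Eventually.of_forall fun v => (Real.exp_pos _).le) hm]
    exact ENNReal.toReal_mono MG_lt.ne h

lemma dotp_abs_le {d : ℕ} {x y : Fin d → ℝ} (hx : dotp x x = d) (hy : dotp y y = d) :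
    |dotp x y| ≤ d := by
  apply abs_le_of_sq_le_sq _ (by positivity)
  have := Finset.sum_mul_sq_le_sq_mul_sq Finset.univ x y
  simp only [dotp] at *
  simp_rw [← sq] at hx hy
  rw [hx, hy] at this
  linarith [sq (d : ℝ)]

lemma mgf_bound {φ : ℝ → ℝ} {L : NNReal} (hL : LipschitzWith L φ) :
    ∃ s0 : ℝ, 0 < s0 ∧ ∃ C1 : ℝ, 0 < C1 ∧ ∀ d : ℕ, 0 < d → ∀ x y : Fin d → ℝ,
      dotp x x = d → dotp y y = d → ∀ s : ℝ, |s| ≤ s0 →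
      ∫⁻ v, ENNReal.ofReal (Real.exp (s * (dotp v x * φ (dotp v y) -
        hermiteCoeff φ 1 * (dotp x y / d)))) ∂(gv d) ≤ ENNReal.ofReal (Real.exp (C1 * s ^ 2)) := by
  set B : ℝ := |φ 0| + L + |hermiteCoeff φ 1| + 1 with hB
  have hBpos : 0 < B := by positivity
  set s0 : ℝ := 1 / (16 * B) with hs0
  have hs0pos : 0 < s0 := by positivity
  have hMG : 0 < MG.toReal := ENNReal.toReal_pos (by have := MG_ge; intro h; simp [h] at this) MG_lt.ne
  refine ⟨s0, hs0pos, (2 / s0 ^ 2) * (Real.exp (1/8) * (MG.toReal + MG.toReal)), by positivity, ?_⟩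
  intro d hd x y hx hy s hs
  have hd' : (0 : ℝ) < d := by positivity
  set m := hermiteCoeff φ 1 * (dotp x y / d) with hm
  have hmle : |m| ≤ |hermiteCoeff φ 1| := by
    rw [hm, abs_mul]
    refine mul_le_of_le_one_right (abs_nonneg _) ?_
    rw [abs_div, abs_of_pos hd', div_le_one hd']
    exact dotp_abs_le hx hy
  have iX : Integrable (fun v => dotp v x * φ (dotp v y)) (gv d) :=
    (dot_memLp x).integrable_mul (phi_memLp hL y)
  have iY : Integrable (fun v => dotp v x * φ (dotp v y) - m) (gv d) := iX.sub (integrable_const _)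
  have zY : ∫ v, (dotp v x * φ (dotp v y) - m) ∂(gv d) = 0 := by
    rw [integral_sub iX (integrable_const _), mean_xy hL hd hy]
    simp [hm]
  obtain ⟨ix, bx⟩ := int_sqexp hd hx
  obtain ⟨iy, bv⟩ := int_sqexp hd hy
  set H : (Fin d → ℝ) → ℝ := fun v => (2 / s0 ^ 2) * (Real.exp (1/8) *
    (Real.exp ((dotp v x) ^ 2 / 4) + Real.exp ((dotp v y) ^ 2 / 4))) with hH
  have iH : Integrable H (gv d) := ((ix.add iy).const_mul _).const_mul _
  have bH : ∫ v, H v ∂(gv d) ≤ (2 / s0 ^ 2) * (Real.exp (1/8) * (MG.toReal + MG.toReal)) := by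
    rw [hH, integral_const_mul, integral_const_mul, integral_add ix iy]
    gcongr
  have hpt : ∀ v, Real.exp (s * (dotp v x * φ (dotp v y) - m)) ≤
      1 + s * (dotp v x * φ (dotp v y) - m) + s ^ 2 * H v := by
    intro v
    set g := dotp v x
    set k := dotp v y
    have hY : |g * φ k - m| ≤ B * (1 + (g ^ 2 + k ^ 2)) := by
      have h1 : |g * φ k - m| ≤ |g| * |φ k| + |m| := by
        rw [← abs_mul]; exact abs_sub _ _
      have h2 : |g| * |φ k| ≤ |g| * (|φ 0| + L * |k|) :=
        mul_le_mul_of_nonneg_left (lip_bound hL k) (abs_nonneg _)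
      have h3 : |g| ≤ 1 + (g ^ 2 + k ^ 2) := by
        rw [← sq_abs g]; nlinarith [sq_nonneg (|g| - 1), sq_nonneg k, sq_nonneg |g|]
      have h4 : |g| * |k| ≤ 1 + (g ^ 2 + k ^ 2) := by
        rw [← sq_abs g, ← sq_abs k]
        nlinarith [sq_nonneg (|g| - |k|), sq_nonneg (|g|), sq_nonneg (|k|)]
      have h5 := mul_le_mul_of_nonneg_left h3 (abs_nonneg (φ 0))
      have h6 := mul_le_mul_of_nonneg_left h4 (L.coe_nonneg)
      have h7 : |hermiteCoeff φ 1| * 1 ≤ |hermiteCoeff φ 1| * (1 + (g ^ 2 + k ^ 2)) :=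
        mul_le_mul_of_nonneg_left (by nlinarith [sq_nonneg g, sq_nonneg k]) (abs_nonneg _)
      rw [hB]
      nlinarith [sq_nonneg g, sq_nonneg k]
    have hY2 : 2 * s0 * |g * φ k - m| ≤ 1/8 + (g ^ 2 + k ^ 2) / 8 := by
      calc 2 * s0 * |g * φ k - m| ≤ 2 * s0 * (B * (1 + (g ^ 2 + k ^ 2))) := by gcongr
        _ = _ := by rw [hs0]; field_simp; ring
    refine (exp_dom hs0pos hs hY2).trans ?_
    have := exp_split (g ^ 2) (k ^ 2)
    simp only [hH]
    gcongr
  have i1 : Integrable (fun v => 1 + s * (dotp v x * φ (dotp v y) - m)) (gv d) :=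
    (integrable_const _).add (iY.const_mul _)
  have iR : Integrable (fun v => 1 + s * (dotp v x * φ (dotp v y) - m) + s ^ 2 * H v) (gv d) :=
    ((integrable_const _).add (iY.const_mul _)).add (iH.const_mul _)
  calc ∫⁻ v, ENNReal.ofReal (Real.exp (s * (dotp v x * φ (dotp v y) - m))) ∂(gv d)
      ≤ ∫⁻ v, ENNReal.ofReal (1 + s * (dotp v x * φ (dotp v y) - m) + s ^ 2 * H v) ∂(gv d) :=
        lintegral_mono fun v => ENNReal.ofReal_le_ofReal (hpt v)
    _ = ENNReal.ofReal (∫ v, (1 + s * (dotp v x * φ (dotp v y) - m) + s ^ 2 * H v) ∂(gv d)) :=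
        (ofReal_integral_eq_lintegral_ofReal iR
          (Eventually.of_forall fun v => (Real.exp_pos _).le.trans (hpt v))).symm
    _ ≤ _ := by
      apply ENNReal.ofReal_le_ofReal
      rw [integral_add i1 (iH.const_mul _),
        integral_add (integrable_const _) (iY.const_mul _), integral_const_mul, integral_const_mul, zY]
      simp only [integral_const, probReal_univ, smul_eq_mul, mul_zero, add_zero, one_mul]
      refine le_trans ?_ (Real.add_one_le_exp _)
      nlinarith [mul_le_mul_of_nonneg_left bH (sq_nonneg s)]

lemma lint_exp_pi {E : Type*} [MeasurableSpace E] (ν : Measure E) [IsProbabilityMeasure ν]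
    (p : ℕ) (f : E → ℝ) (hf : Measurable f) :
    ∫⁻ V, ENNReal.ofReal (Real.exp (∑ k, f (V k))) ∂(Measure.pi fun _ : Fin p => ν) =
      (∫⁻ v, ENNReal.ofReal (Real.exp (f v)) ∂ν) ^ p := by
  have hg : Measurable (fun v => ENNReal.ofReal (Real.exp (f v))) := by fun_prop
  have h : iIndepFun (fun (i : Fin p) (V : Fin p → E) => ENNReal.ofReal (Real.exp (f (V i))))
      (Measure.pi fun _ : Fin p => ν) :=
    iIndepFun_pi (X := fun _ v ↦ ENNReal.ofReal (Real.exp (f v))) (fun _ ↦ hg.aemeasurable)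
  have h2 := lintegral_prod_eq_prod_lintegral_of_indepFun Finset.univ _ h
    (fun i => hg.comp (measurable_pi_apply i))
  simp_rw [Real.exp_sum, ENNReal.ofReal_prod_of_nonneg (fun i _ => (Real.exp_pos _).le)]
  rw [h2]
  have h3 : ∀ i : Fin p, ∫⁻ V, ENNReal.ofReal (Real.exp (f (V i))) ∂(Measure.pi fun _ : Fin p => ν) =
      ∫⁻ v, ENNReal.ofReal (Real.exp (f v)) ∂ν := fun i =>
    (measurePreserving_eval (fun _ : Fin p => ν) i).lintegral_comp hg
  simp [h3]

lemma chernoff {E : Type*} [MeasurableSpace E] (ν : Measure E) [IsProbabilityMeasure ν]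
    (p : ℕ) (f : E → ℝ) (hf : Measurable f) (c T : ℝ)
    (h : ∫⁻ v, ENNReal.ofReal (Real.exp (f v)) ∂ν ≤ ENNReal.ofReal (Real.exp c)) :
    (Measure.pi fun _ : Fin p => ν) {V | T ≤ ∑ k, f (V k)} ≤
      ENNReal.ofReal (Real.exp (p * c - T)) := by
  have hm : Measurable (fun V : Fin p → E => ENNReal.ofReal (Real.exp (∑ k, f (V k)))) := by
    fun_prop
  have h1 : (Measure.pi fun _ : Fin p => ν) {V | T ≤ ∑ k, f (V k)} ≤
      (Measure.pi fun _ : Fin p => ν) {V | ENNReal.ofReal (Real.exp T) ≤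
        ENNReal.ofReal (Real.exp (∑ k, f (V k)))} := by
    refine measure_mono fun V hV => ?_
    exact ENNReal.ofReal_le_ofReal (Real.exp_le_exp.2 hV)
  refine h1.trans ((meas_ge_le_lintegral_div hm.aemeasurable (by simp [Real.exp_pos]) (by simp)).trans ?_)
  rw [lint_exp_pi ν p f hf]
  calc _ ≤ (ENNReal.ofReal (Real.exp c)) ^ p / ENNReal.ofReal (Real.exp T) := by gcongr
    _ = _ := by
      rw [← ENNReal.ofReal_pow (Real.exp_pos _).le, ← ENNReal.ofReal_div_of_pos (Real.exp_pos _),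
        ← Real.exp_nat_mul, ← Real.exp_sub]

/-- quadratic form -/
def QF {p d : ℕ} (V : Fin p → Fin d → ℝ) (w : Fin d → ℝ) : ℝ := ∑ k, (dotp (V k) w) ^ 2

lemma dotp_add' {d : ℕ} (v x y : Fin d → ℝ) : dotp v (x + y) = dotp v x + dotp v y := by
  simp [dotp, mul_add, Finset.sum_add_distrib]

lemma dotp_sub' {d : ℕ} (v x y : Fin d → ℝ) : dotp v (x - y) = dotp v x - dotp v y := by
  simp [dotp, mul_sub, Finset.sum_sub_distrib]

lemma dotp_smul' {d : ℕ} (v x : Fin d → ℝ) (r : ℝ) : dotp v (r • x) = r * dotp v x := by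
  simp only [dotp, Finset.mul_sum, Pi.smul_apply, smul_eq_mul]
  exact Finset.sum_congr rfl fun i _ => by ring

lemma dotp_self_nonneg {d : ℕ} (v : Fin d → ℝ) : 0 ≤ dotp v v :=
  Finset.sum_nonneg fun _ _ => mul_self_nonneg _

lemma QF_nonneg {p d : ℕ} (V : Fin p → Fin d → ℝ) (w : Fin d → ℝ) : 0 ≤ QF V w :=
  Finset.sum_nonneg fun _ _ => sq_nonneg _

lemma QF_par {p d : ℕ} (V : Fin p → Fin d → ℝ) (u h : Fin d → ℝ) :
    QF V (u + h) + QF V (u - h) = 2 * QF V u + 2 * QF V h := by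
  simp only [QF, Finset.mul_sum, ← Finset.sum_add_distrib, dotp_add', dotp_sub']
  exact Finset.sum_congr rfl fun i _ => by ring

lemma dotp_par {d : ℕ} (u h : Fin d → ℝ) :
    dotp (u + h) (u + h) + dotp (u - h) (u - h) = 2 * dotp u u + 2 * dotp h h := by
  simp only [dotp, Finset.mul_sum, ← Finset.sum_add_distrib, Pi.add_apply, Pi.sub_apply]
  exact Finset.sum_congr rfl fun i _ => by ring

lemma QF_smul {p d : ℕ} (V : Fin p → Fin d → ℝ) (u : Fin d → ℝ) (r : ℝ) :
    QF V (r • u) = r ^ 2 * QF V u := by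
  simp only [QF, Finset.mul_sum, dotp_smul', mul_pow]

lemma cont_dotp {d : ℕ} : Continuous (fun q : (Fin d → ℝ) × (Fin d → ℝ) => dotp q.1 q.2) := by
  unfold dotp; fun_prop

lemma cont_QF {p d : ℕ} : Continuous (fun q : (Fin p → Fin d → ℝ) × (Fin d → ℝ) => QF q.1 q.2) := by
  unfold QF dotp; fun_prop

/-- Euclidean ball in the function space. -/
def EB (d : ℕ) (r : ℝ) : Set (Fin d → ℝ) := {w | dotp w w ≤ r}

lemma EB_closed (d : ℕ) (r : ℝ) : IsClosed (EB d r) := by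
  unfold EB dotp
  exact isClosed_le (by fun_prop) (by fun_prop)

lemma EB_meas (d : ℕ) (r : ℝ) : MeasurableSet (EB d r) := (EB_closed d r).measurableSet

open Pointwise in
lemma EB_vol (d : ℕ) : volume (EB d 4) = 2 ^ d * volume (EB d 1) := by
  have : EB d 4 = (2 : ℝ) • EB d 1 := by
    ext w
    rw [Set.mem_smul_set_iff_inv_smul_mem₀ two_ne_zero]
    simp only [EB, Set.mem_ofPred_eq]
    rw [dotp_smul', dotp_comm (_ • w), dotp_smul']
    constructor <;> intro h <;> linarith
  rw [this, Measure.addHaar_smul]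
  simp

lemma EB_pos (d : ℕ) : volume (EB d 1) ≠ 0 := by
  have hn : EB d 1 ∈ nhds (0 : Fin d → ℝ) := by
    have ho : IsOpen {w : Fin d → ℝ | dotp w w < 1} := by
      unfold dotp
      exact isOpen_lt (by fun_prop) (by fun_prop)
    refine mem_of_superset (ho.mem_nhds (by simp [dotp])) ?_
    intro w hw
    have hw' : dotp w w < 1 := hw
    exact hw'.le
  exact (MeasureTheory.Measure.measure_pos_of_mem_nhds volume hn).ne'

lemma EB_fin (d : ℕ) : volume (EB d 1) ≠ ⊤ := by
  have : EB d 1 ⊆ Metric.closedBall 0 1 := by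
    intro w hw
    rw [mem_closedBall_zero_iff, pi_norm_le_iff_of_nonneg zero_le_one]
    intro i
    have h1 : w i * w i ≤ dotp w w :=
      Finset.single_le_sum (f := fun j => w j * w j) (fun j _ => mul_self_nonneg _) (Finset.mem_univ i)
    have h2 : dotp w w ≤ 1 := hw
    rw [Real.norm_eq_abs]
    exact abs_le_one_iff_mul_self_le_one.2 (h1.trans h2)
  exact ((measure_mono this).trans_lt (isCompact_closedBall _ _).measure_lt_top).ne

/-- volume average of exponential of the quadratic form -/
def ZF {p d : ℕ} (l : ℝ) (V : Fin p → Fin d → ℝ) : ENNReal :=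
  ∫⁻ w in EB d 4, ENNReal.ofReal (Real.exp (l * QF V w))

lemma ZF_lower {p d : ℕ} (l : ℝ) (hl : 0 ≤ l) (V : Fin p → Fin d → ℝ) (u : Fin d → ℝ)
    (hu : u ∈ EB d 1) :
    ENNReal.ofReal (Real.exp (l * QF V u)) * volume (EB d 1) ≤ 2 * ZF l V := by
  set F : (Fin d → ℝ) → ENNReal := fun w => ENNReal.ofReal (Real.exp (l * QF V w)) with hF
  have hQ : Continuous (fun w => QF V w) := cont_QF.comp (by fun_prop : Continuous fun w : Fin d → ℝ => (V, w))
  have hFm : Measurable F := by have := hQ.measurable; fun_prop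
  have hmem : ∀ h ∈ EB d 1, u + h ∈ EB d 4 ∧ u - h ∈ EB d 4 := by
    intro h hh
    have := dotp_par u h
    have h1 := dotp_self_nonneg (u + h)
    have h2 := dotp_self_nonneg (u - h)
    simp only [EB, Set.mem_ofPred_eq] at *
    constructor <;> linarith
  have hplus : ∫⁻ h in EB d 1, F (u + h) ≤ ZF l V := by
    rw [← lintegral_indicator (EB_meas d 1), ZF, ← lintegral_indicator (EB_meas d 4),
      ← lintegral_add_left_eq_self ((EB d 4).indicator _) u]
    refine lintegral_mono fun h => ?_
    by_cases hh : h ∈ EB d 1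
    · simp [hh, (hmem h hh).1, hF]
    · simp [hh]
  have hminus : ∫⁻ h in EB d 1, F (u - h) ≤ ZF l V := by
    rw [← lintegral_indicator (EB_meas d 1), ZF, ← lintegral_indicator (EB_meas d 4),
      ← lintegral_sub_left_eq_self ((EB d 4).indicator _) u]
    refine lintegral_mono fun h => ?_
    by_cases hh : h ∈ EB d 1
    · simp [hh, (hmem h hh).2, hF]
    · simp [hh]
  calc F u * volume (EB d 1) = ∫⁻ h in EB d 1, F u := by simp
    _ ≤ ∫⁻ h in EB d 1, (F (u + h) + F (u - h)) := by
      refine lintegral_mono fun h => ?_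
      have := QF_par V u h
      have h3 := QF_nonneg V h
      rcases le_total (QF V u) (QF V (u + h)) with h1 | h1
      · exact le_add_right (ENNReal.ofReal_le_ofReal (Real.exp_le_exp.2 (by gcongr)))
      · have h2 : QF V u ≤ QF V (u - h) := by linarith
        exact le_add_left (ENNReal.ofReal_le_ofReal (Real.exp_le_exp.2 (by gcongr)))
    _ = (∫⁻ h in EB d 1, F (u + h)) + ∫⁻ h in EB d 1, F (u - h) :=
      lintegral_add_left (by fun_prop) _
    _ ≤ 2 * ZF l V := by rw [two_mul]; gcongr

lemma ZF_mean {p d : ℕ} (hd : 0 < d) :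
    ∫⁻ V, ZF ((d : ℝ) / 16) V ∂(gaussianMatrix p d) ≤ volume (EB d 4) * MG ^ p := by
  have hd' : (0 : ℝ) < d := by positivity
  unfold ZF
  have hsf : SFinite (gaussianMatrix p d) := by unfold gaussianMatrix; infer_instance
  rw [lintegral_lintegral_swap]
  · calc _ ≤ ∫⁻ w in EB d 4, MG ^ p := by
          refine setLIntegral_mono' (EB_meas d 4) fun w hw => ?_
          have h := lint_exp_pi (gv d) p (fun v => (d : ℝ) / 16 * (dotp v w) ^ 2) (by fun_prop)
          have h2 : ∀ V : Fin p → Fin d → ℝ, (d : ℝ) / 16 * QF V w =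
              ∑ k, (d : ℝ) / 16 * (dotp (V k) w) ^ 2 := fun V => by rw [QF, Finset.mul_sum]
          simp_rw [h2]
          refine h.le.trans ?_
          gcongr
          refine lint_dot hd w _ (Real.sqrt (dotp w w / d)) ?_ ?_
          · rw [Real.sq_sqrt (div_nonneg (dotp_self_nonneg _) hd'.le)]; field_simp
          · rw [Real.sq_sqrt (div_nonneg (dotp_self_nonneg _) hd'.le)]
            have : dotp w w ≤ 4 := hw
            field_simp; linarith
      _ = _ := by simp [mul_comm]
  · have := cont_QF (p := p) (d := d)
    have h2 : Continuous (fun q : (Fin p → Fin d → ℝ) × (Fin d → ℝ) =>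
      Real.exp ((d : ℝ) / 16 * QF q.1 q.2)) := by fun_prop
    exact (ENNReal.measurable_ofReal.comp h2.measurable).aemeasurable

lemma op_norm : ∃ C0 : ℝ, 0 < C0 ∧ ∀ p d : ℕ, 0 < d → d ≤ p →
    gaussianMatrix p d {V | ¬ ∀ u, QF V u ≤ C0 * (p / d) * dotp u u} ≤
      ENNReal.ofReal (Real.exp (-p)) := by
  have hM1 : 1 ≤ MG.toReal := by
    have := ENNReal.toReal_mono MG_lt.ne MG_ge
    simpa using this
  have hMe : MG = ENNReal.ofReal (Real.exp (Real.log MG.toReal)) := by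
    rw [Real.exp_log (by linarith), ENNReal.ofReal_toReal MG_lt.ne]
  have hlM : 0 ≤ Real.log MG.toReal := Real.log_nonneg hM1
  set m := Real.log MG.toReal with hm
  refine ⟨16 * (2 + 1 + m), by positivity, ?_⟩
  intro p d hd hdp
  have hd' : (0 : ℝ) < d := by positivity
  set b := volume (EB d 4) * MG ^ p with hb
  have hb0 : b ≠ 0 := by
    rw [hb, EB_vol]
    have h1 := EB_pos d
    have h2 : MG ≠ 0 := by have := MG_ge; intro h; simp [h] at this
    simp [h1, h2]
  have hbt : b ≠ ⊤ := by
    rw [hb, EB_vol]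
    refine ENNReal.mul_ne_top (ENNReal.mul_ne_top (by simp) (EB_fin d)) (by simp [MG_lt.ne])
  set a := b * ENNReal.ofReal (Real.exp p) with ha
  have he0 : ENNReal.ofReal (Real.exp p) ≠ 0 := by simp [Real.exp_pos]
  have ha0 : a ≠ 0 := mul_ne_zero hb0 he0
  have hat : a ≠ ⊤ := ENNReal.mul_ne_top hbt (by simp)
  have hmeas : Measurable (fun V : Fin p → Fin d → ℝ => ZF ((d : ℝ) / 16) V) := by
    have := cont_QF (p := p) (d := d)
    have h2 : Continuous (fun q : (Fin p → Fin d → ℝ) × (Fin d → ℝ) =>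
      Real.exp ((d : ℝ) / 16 * QF q.1 q.2)) := by fun_prop
    exact (ENNReal.measurable_ofReal.comp h2.measurable).lintegral_prod_right'
  have hmk : gaussianMatrix p d {V | a ≤ ZF ((d : ℝ) / 16) V} ≤ ENNReal.ofReal (Real.exp (-p)) := by
    refine (meas_ge_le_lintegral_div hmeas.aemeasurable ha0 hat).trans ?_
    refine (ENNReal.div_le_div_right (ZF_mean hd) a).trans ?_
    rw [← hb, ha]
    apply ENNReal.div_le_of_le_mul
    rw [mul_comm b, ← mul_assoc, ← ENNReal.ofReal_mul (Real.exp_pos _).le, ← Real.exp_add]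
    simp
  refine (measure_mono ?_).trans hmk
  intro V hV
  by_contra hcon
  apply hV
  have hZ : ZF ((d : ℝ) / 16) V ≤ a := (not_le.1 hcon).le
  have hball : ∀ u ∈ EB d 1, QF V u ≤ 16 * (2 + 1 + m) * (p / d) := by
    intro u hu
    have h1 := ZF_lower ((d : ℝ) / 16) (by positivity) V u hu
    have h2 : ENNReal.ofReal (Real.exp ((d : ℝ) / 16 * QF V u)) * volume (EB d 1) ≤
        (2 * 2 ^ d * MG ^ p * ENNReal.ofReal (Real.exp p)) * volume (EB d 1) := by
      refine h1.trans ?_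
      calc 2 * ZF ((d : ℝ) / 16) V ≤ 2 * a := by gcongr
        _ = _ := by rw [ha, hb, EB_vol]; ring
    have h3 := (ENNReal.mul_le_mul_iff_left (EB_pos d) (EB_fin d)).1 h2
    have h2e : (2 : ENNReal) = ENNReal.ofReal (Real.exp (Real.log 2)) := by
      rw [Real.exp_log (by norm_num)]; simp
    rw [hMe, h2e, ← ENNReal.ofReal_pow (Real.exp_pos _).le, ← ENNReal.ofReal_pow (Real.exp_pos _).le,
      ← ENNReal.ofReal_mul (by positivity), ← ENNReal.ofReal_mul (by positivity),
      ← ENNReal.ofReal_mul (by positivity), ENNReal.ofReal_le_ofReal_iff (by positivity),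
      ← Real.exp_nat_mul, ← Real.exp_nat_mul, ← Real.exp_add, ← Real.exp_add, ← Real.exp_add,
      Real.exp_le_exp] at h3
    have hl2 : Real.log 2 ≤ 1 := by linarith [Real.log_two_lt_d9]
    have hl0 : 0 < Real.log 2 := Real.log_pos (by norm_num)
    have hdp' : (d : ℝ) ≤ p := by exact_mod_cast hdp
    have hd1 : (1 : ℝ) ≤ d := by exact_mod_cast hd
    have h4 : (d : ℝ) / 16 * QF V u ≤ (2 + 1 + m) * p := by
      have : (d : ℝ) * Real.log 2 ≤ d * 1 := by gcongr
      nlinarith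
    rw [← mul_div_assoc, le_div_iff₀ hd']
    linarith
  intro u
  rcases (dotp_self_nonneg u).eq_or_lt with h0 | h0
  · have hu : u = 0 := by
      funext i
      have h1 : u i * u i ≤ dotp u u :=
        Finset.single_le_sum (f := fun j => u j * u j) (fun j _ => mul_self_nonneg _) (Finset.mem_univ i)
      rw [← h0] at h1
      simpa using le_antisymm h1 (mul_self_nonneg _)
    subst hu
    simp [QF, dotp]
  · have hs : 0 < Real.sqrt (dotp u u) := Real.sqrt_pos.2 h0
    have h1 := hball ((Real.sqrt (dotp u u))⁻¹ • u) (by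
      simp only [EB, Set.mem_ofPred_eq]
      rw [dotp_smul', dotp_comm (_ • u), dotp_smul', ← mul_assoc, ← mul_inv, Real.mul_self_sqrt h0.le]
      rw [inv_mul_cancel₀ h0.ne'])
    rw [QF_smul, inv_pow, Real.sq_sqrt h0.le, inv_mul_le_iff₀ h0] at h1
    linarith

lemma eNorm_sq {d : ℕ} (x : Fin d → ℝ) : eNorm x ^ 2 = dotp x x := by
  unfold eNorm dotp
  rw [Real.sq_sqrt (Finset.sum_nonneg fun _ _ => sq_nonneg _)]
  simp_rw [sq]

lemma eNorm_nonneg {d : ℕ} (x : Fin d → ℝ) : 0 ≤ eNorm x := Real.sqrt_nonneg _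

lemma dotp_of_eNorm {d : ℕ} {x : Fin d → ℝ} (h : eNorm x = Real.sqrt d) : dotp x x = d := by
  rw [← eNorm_sq, h, Real.sq_sqrt (by positivity)]

lemma dotp_sq_le {d : ℕ} (x y : Fin d → ℝ) : dotp x y ^ 2 ≤ dotp x x * dotp y y := by
  have := Finset.sum_mul_sq_le_sq_mul_sq Finset.univ x y
  simp only [dotp]
  simp_rw [← sq]
  exact this

lemma subg_tail {d : ℕ} (hd : 0 < d) {P : Measure (Fin d → ℝ)} {K : ℝ} (h : DataAssumption P K)
    {u : Fin d → ℝ} (hu : eNorm u = 1) {s : ℝ} (hs : 0 ≤ s) :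
    P {x | s ≤ |dotp u x|} ≤ ENNReal.ofReal (2 * Real.exp (-(s ^ 2 / (|K| + 1) ^ 2))) := by
  have := h.prob
  have hd' : (0 : ℝ) < d := by positivity
  have hl2 : 0 < Real.log 2 := Real.log_pos (by norm_num)
  have hbd : ∀ w : Fin d → ℝ, eNorm w = 1 → ∀ᵐ x ∂P, (dotp w x) ^ 2 ≤ d := by
    intro w hw
    filter_upwards [h.norm_eq] with x hx
    have h1 := dotp_sq_le w x
    rw [← eNorm_sq w, hw, dotp_of_eNorm hx] at h1
    linarith
  have hmd : ∀ w : Fin d → ℝ, Measurable (fun x => dotp w x) := by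
    intro w
    have h := meas_dot w
    simp_rw [dotp_comm w]
    exact h
  have hint : ∀ w : Fin d → ℝ, eNorm w = 1 → ∀ t : ℝ,
      Integrable (fun x => Real.exp ((dotp w x) ^ 2 / t ^ 2)) P := by
    intro w hw t
    have := hmd w
    refine Integrable.of_bound (C := Real.exp (d / t ^ 2))
      (Measurable.aestronglyMeasurable (by fun_prop)) ?_
    filter_upwards [hbd w hw] with x hx
    rw [Real.norm_eq_abs, abs_of_pos (Real.exp_pos _)]
    gcongr
  have ht0 : ∀ w : Fin d → ℝ, eNorm w = 1 →
      Real.sqrt (d / Real.log 2) ∈ {t : ℝ | 0 < t ∧ ∫ x, Real.exp ((dotp w x) ^ 2 / t ^ 2) ∂P ≤ 2} := by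
    intro w hw
    refine ⟨Real.sqrt_pos.2 (by positivity), ?_⟩
    have : ∫ x, Real.exp ((dotp w x) ^ 2 / Real.sqrt (d / Real.log 2) ^ 2) ∂P ≤ ∫ x, (2 : ℝ) ∂P := by
      refine integral_mono_ae (hint w hw _) (integrable_const _) ?_
      filter_upwards [hbd w hw] with x hx
      rw [Real.sq_sqrt (by positivity)]
      calc Real.exp (dotp w x ^ 2 / (d / Real.log 2)) ≤ Real.exp (d / (d / Real.log 2)) := by gcongr
        _ = 2 := by
          rw [div_div_cancel₀ hd'.ne', Real.exp_log (by norm_num)]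
    simpa using this
  have hbb : ∀ w : Fin d → ℝ,
      BddBelow {t : ℝ | 0 < t ∧ ∫ x, Real.exp ((dotp w x) ^ 2 / t ^ 2) ∂P ≤ 2} :=
    fun w => ⟨0, fun t ht => ht.1.le⟩
  have hle : sInf {t : ℝ | 0 < t ∧ ∫ x, Real.exp ((dotp u x) ^ 2 / t ^ 2) ∂P ≤ 2} ≤ K := by
    refine le_trans ?_ h.subg
    unfold vecSubGNorm
    refine le_ciSup (f := fun u : {u : Fin d → ℝ // eNorm u = 1} =>
      sInf {t : ℝ | 0 < t ∧ ∫ x, Real.exp ((dotp u.1 x) ^ 2 / t ^ 2) ∂P ≤ 2}) ?_ ⟨u, hu⟩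
    refine ⟨Real.sqrt (d / Real.log 2), ?_⟩
    rintro _ ⟨w, rfl⟩
    exact csInf_le (hbb w.1) (ht0 w.1 w.2)
  obtain ⟨t, ⟨htpos, htint⟩, htK⟩ := exists_lt_of_csInf_lt ⟨_, ht0 u hu⟩
    (lt_of_le_of_lt hle (by linarith [le_abs_self K] : K < |K| + 1))
  have hmu := hmd u
  have hmk := mul_meas_ge_le_integral_of_nonneg (μ := P)
    (f := fun x => Real.exp ((dotp u x) ^ 2 / t ^ 2))
    (Eventually.of_forall fun x => (Real.exp_pos _).le) (hint u hu t) (Real.exp (s ^ 2 / t ^ 2))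
  have hsub : P {x | s ≤ |dotp u x|} ≤
      P {x | Real.exp (s ^ 2 / t ^ 2) ≤ Real.exp ((dotp u x) ^ 2 / t ^ 2)} := by
    refine measure_mono fun x hx => ?_
    have hx' : s ≤ |dotp u x| := hx
    show Real.exp (s ^ 2 / t ^ 2) ≤ Real.exp ((dotp u x) ^ 2 / t ^ 2)
    rw [← sq_abs (dotp u x)]
    gcongr
  refine hsub.trans ?_
  rw [← ofReal_measureReal]
  apply ENNReal.ofReal_le_ofReal
  have h1 : P.real {x | Real.exp (s ^ 2 / t ^ 2) ≤ Real.exp ((dotp u x) ^ 2 / t ^ 2)} ≤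
      2 * Real.exp (-(s ^ 2 / t ^ 2)) := by
    rw [Real.exp_neg, ← div_eq_mul_inv, le_div_iff₀ (Real.exp_pos _), mul_comm]
    exact hmk.trans htint
  refine h1.trans ?_
  gcongr

lemma prod_bound {A B : Type*} [MeasurableSpace A] [MeasurableSpace B] (μ : Measure A) (ν : Measure B)
    [IsProbabilityMeasure μ] [IsProbabilityMeasure ν] {N : Set (A × B)} (hN : MeasurableSet N)
    (b : ENNReal) (h : ∀ y, μ {x | (x, y) ∈ N} ≤ b) : (μ.prod ν) N ≤ b := by
  rw [Measure.prod_apply_symm hN]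
  calc _ ≤ ∫⁻ _, b ∂ν := lintegral_mono fun y => h y
    _ = b := by simp

lemma data_bound {d : ℕ} (hd : 0 < d) {P : Measure (Fin d → ℝ)} {K : ℝ} (h : DataAssumption P K)
    {s : ℝ} (hs : 0 ≤ s) :
    (Measure.pi fun _ : Fin 2 => P) {x | Real.sqrt d * s < |dotp (x 0) (x 1)| ∧ dotp (x 1) (x 1) = d} ≤
      ENNReal.ofReal (2 * Real.exp (-(s ^ 2 / (|K| + 1) ^ 2))) := by
  have := h.prob
  have hd' : (0 : ℝ) < d := by positivity
  have hsd : 0 < Real.sqrt d := Real.sqrt_pos.2 hd'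
  have hc := cont_dotp (d := d)
  have hc2 : Continuous (fun q : (Fin d → ℝ) × (Fin d → ℝ) => dotp q.2 q.2) := by
    unfold dotp; fun_prop
  have hN : MeasurableSet {q : (Fin d → ℝ) × (Fin d → ℝ) |
      Real.sqrt d * s < |dotp q.1 q.2| ∧ dotp q.2 q.2 = d} := by
    have h1 := hc.measurable
    have h2 := hc2.measurable
    exact (measurableSet_lt measurable_const h1.abs).inter
      (measurableSet_eq_fun h2 measurable_const)
  have hmp := measurePreserving_finTwoArrow P
  have he := hmp.measure_preimage hN.nullMeasurableSet
  refine (le_of_eq he).trans ?_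
  refine prod_bound P P hN _ fun y => ?_
  by_cases hy : dotp y y = d
  · have hu : eNorm ((Real.sqrt d)⁻¹ • y) = 1 := by
      have : eNorm ((Real.sqrt d)⁻¹ • y) ^ 2 = 1 := by
        rw [eNorm_sq, dotp_smul', dotp_comm (_ • y), dotp_smul', hy, ← mul_assoc, ← mul_inv,
          Real.mul_self_sqrt hd'.le, inv_mul_cancel₀ hd'.ne']
      exact (pow_eq_one_iff_of_nonneg (eNorm_nonneg _) two_ne_zero).1 this
    refine (measure_mono ?_).trans (subg_tail hd h hu hs)
    intro x hx
    have hx' : Real.sqrt d * s < |dotp x y| := hx.1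
    show s ≤ |dotp ((Real.sqrt d)⁻¹ • y) x|
    rw [dotp_comm, dotp_smul', abs_mul, abs_of_pos (inv_pos.2 hsd), le_inv_mul_iff₀ hsd]
    exact hx'.le
  · have : {x | (x, y) ∈ {q : (Fin d → ℝ) × (Fin d → ℝ) |
      Real.sqrt d * s < |dotp q.1 q.2| ∧ dotp q.2 q.2 = d}} = ∅ := by
      ext x; simp [hy]
    rw [this]; simp

lemma norm_null {d : ℕ} {P : Measure (Fin d → ℝ)} {K : ℝ} (h : DataAssumption P K) (i : Fin 2) :
    (Measure.pi fun _ : Fin 2 => P) {x | dotp (x i) (x i) ≠ d} = 0 := by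
  have := h.prob
  have hq := (measurePreserving_eval (fun _ : Fin 2 => P) i).quasiMeasurePreserving.ae h.norm_eq
  have : ∀ᵐ x ∂(Measure.pi fun _ : Fin 2 => P), dotp (x i) (x i) = d := by
    filter_upwards [hq] with x hx
    exact dotp_of_eNorm hx
  exact this

/-- centred test statistic -/
def TS {p d : ℕ} (φ : ℝ → ℝ) (V : Fin p → Fin d → ℝ) (x y : Fin d → ℝ) : ℝ :=
  ∑ k, dotp (V k) x * φ (dotp (V k) y)

lemma two_sided {φ : ℝ → ℝ} {L : NNReal} (hL : LipschitzWith L φ) :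
    ∃ s0 : ℝ, 0 < s0 ∧ ∃ C1 : ℝ, 0 < C1 ∧ ∀ p d : ℕ, 0 < d → ∀ x y : Fin d → ℝ,
      dotp x x = d → dotp y y = d → ∀ s : ℝ, 0 < s → s ≤ s0 → ∀ τ : ℝ,
      gaussianMatrix p d {V | p * τ < |TS φ V x y - p * (hermiteCoeff φ 1 * (dotp x y / d))|} ≤
        ENNReal.ofReal (2 * Real.exp (p * (C1 * s ^ 2 - s * τ))) := by
  obtain ⟨s0, hs0, C1, hC1, H⟩ := mgf_bound hL
  refine ⟨s0, hs0, C1, hC1, ?_⟩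
  intro p d hd x y hx hy s hs hss τ
  set m := hermiteCoeff φ 1 * (dotp x y / d) with hm
  have hφm := hL.continuous.measurable
  have e1 := chernoff (gv d) p (fun v => s * (dotp v x * φ (dotp v y) - m)) (by fun_prop)
    (C1 * s ^ 2) (s * (p * τ)) (H d hd x y hx hy s (by rwa [abs_of_pos hs]))
  have e2 := chernoff (gv d) p (fun v => -s * (dotp v x * φ (dotp v y) - m)) (by fun_prop)
    (C1 * (-s) ^ 2) (s * (p * τ)) (H d hd x y hx hy (-s) (by rwa [abs_neg, abs_of_pos hs]))
  have hsum : ∀ (r : ℝ) (V : Fin p → Fin d → ℝ),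
      ∑ k, r * (dotp (V k) x * φ (dotp (V k) y) - m) = r * (TS φ V x y - p * m) := by
    intro r V
    rw [← Finset.mul_sum, Finset.sum_sub_distrib]
    simp [TS]
  simp_rw [hsum] at e1 e2
  have hsub : {V : Fin p → Fin d → ℝ | p * τ < |TS φ V x y - p * m|} ⊆
      {V | s * (p * τ) ≤ s * (TS φ V x y - p * m)} ∪ {V | s * (p * τ) ≤ -s * (TS φ V x y - p * m)} := by
    intro V hV
    have hV' : p * τ < |TS φ V x y - p * m| := hV
    rcases lt_abs.1 hV' with h | h
    · left
      show s * (p * τ) ≤ s * (TS φ V x y - p * m)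
      gcongr
    · right
      show s * (p * τ) ≤ -s * (TS φ V x y - p * m)
      have := mul_le_mul_of_nonneg_left h.le hs.le
      linarith
  refine (measure_mono hsub).trans ((measure_union_le _ _).trans ?_)
  refine (add_le_add e1 e2).trans ?_
  rw [← ENNReal.ofReal_add (Real.exp_pos _).le (Real.exp_pos _).le]
  apply ENNReal.ofReal_le_ofReal
  rw [neg_sq, ← two_mul]
  apply le_of_eq
  ring_nf

lemma TS_diff {φ : ℝ → ℝ} {L : NNReal} (hL : LipschitzWith L φ) {p d : ℕ} (hd : 0 < d) {C0 : ℝ}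
    (hC0 : 0 < C0) (V : Fin p → Fin d → ℝ) (hV : ∀ u, QF V u ≤ C0 * (p / d) * dotp u u)
    {x : Fin d → ℝ} (hx : dotp x x = d) (y z : Fin d → ℝ) :
    |TS φ V x y - TS φ V x z| ≤ p * (L * C0 * (eNorm (y - z) / Real.sqrt d)) := by
  have hd' : (0 : ℝ) < d := by positivity
  have hsd : 0 < Real.sqrt d := Real.sqrt_pos.2 hd'
  have hE := eNorm_nonneg (y - z)
  apply abs_le_of_sq_le_sq _ (by positivity)
  have h1 : TS φ V x y - TS φ V x z =
      ∑ k, dotp (V k) x * (φ (dotp (V k) y) - φ (dotp (V k) z)) := by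
    simp only [TS, ← Finset.sum_sub_distrib, mul_sub]
  have h2 := Finset.sum_mul_sq_le_sq_mul_sq Finset.univ (fun k => dotp (V k) x)
    (fun k => φ (dotp (V k) y) - φ (dotp (V k) z))
  have h3 : ∑ k, (φ (dotp (V k) y) - φ (dotp (V k) z)) ^ 2 ≤ L ^ 2 * QF V (y - z) := by
    rw [QF, Finset.mul_sum]
    refine Finset.sum_le_sum fun k _ => ?_
    have h := hL.dist_le_mul (dotp (V k) y) (dotp (V k) z)
    rw [Real.dist_eq, Real.dist_eq, ← dotp_sub'] at h
    rw [← sq_abs, ← sq_abs (dotp (V k) (y - z)), ← mul_pow]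
    gcongr
  have hA : 0 ≤ C0 * (p / d : ℝ) := by positivity
  rw [h1]
  refine h2.trans ?_
  calc (∑ k, dotp (V k) x ^ 2) * ∑ k, (φ (dotp (V k) y) - φ (dotp (V k) z)) ^ 2
      ≤ (C0 * (p / d) * d) * (L ^ 2 * (C0 * (p / d) * eNorm (y - z) ^ 2)) := by
        have ha := hV x
        rw [hx] at ha
        have hb := hV (y - z)
        rw [← eNorm_sq] at hb
        refine mul_le_mul ha (h3.trans (by gcongr)) (Finset.sum_nonneg fun _ _ => sq_nonneg _)
          (by positivity)
    _ = _ := by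
        rw [mul_pow, mul_pow, div_pow, Real.sq_sqrt hd'.le]
        field_simp

lemma deterministic {φ : ℝ → ℝ} {L : NNReal} (hL : LipschitzWith L φ) {p d : ℕ} (hd : 0 < d)
    (hp : 0 < p) {C0 μ M η : ℝ} (hC0 : 0 < C0) (hμ : μ ≠ 0) (hM : 0 < M)
    (V : Fin p → Fin d → ℝ) (hV : ∀ u, QF V u ≤ C0 * (p / d) * dotp u u)
    {x z : Fin d → ℝ} (hx : dotp x x = d)
    (h1 : |TS φ V x x - p * μ| ≤ p * (|μ| / 2))
    (h2 : |TS φ V x z| ≤ p * (M * η)) (hη : 0 ≤ η)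
    (a b : ℝ) (e f : Fin d → ℝ) (he : eNorm e ≤ |μ| / (4 * (L * C0 + 1)) * Real.sqrt d)
    (heq : featureMap φ V z = (fun k => a * featureMap φ V (x + e) k + b * featureMap φ V (x + f) k)) :
    |a + b| ≤ (4 / |μ| * (L * C0 + M)) * (|b| * (eNorm (f - e) / Real.sqrt d) + η) := by
  have hd' : (0 : ℝ) < d := by positivity
  have hp' : (0 : ℝ) < p := by positivity
  have hsd : 0 < Real.sqrt d := Real.sqrt_pos.2 hd'
  have hμ' : 0 < |μ| := abs_pos.2 hμ
  have t1 := TS_diff hL hd hC0 V hV hx (x + e) x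
  have t2 := TS_diff hL hd hC0 V hV hx (x + f) (x + e)
  rw [add_sub_cancel_left] at t1
  rw [add_sub_add_left_eq_sub] at t2
  set δ := eNorm (f - e) / Real.sqrt d with hδ
  have hδ0 : 0 ≤ δ := div_nonneg (eNorm_nonneg _) hsd.le
  have he' : eNorm e / Real.sqrt d ≤ |μ| / (4 * (L * C0 + 1)) := by
    rwa [div_le_iff₀ hsd]
  have hLC : 0 ≤ (L : ℝ) * C0 := by positivity
  have t1' : |TS φ V x (x + e) - TS φ V x x| ≤ p * (|μ| / 4) := by
    refine t1.trans ?_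
    gcongr
    calc L * C0 * (eNorm e / Real.sqrt d) ≤ L * C0 * (|μ| / (4 * (L * C0 + 1))) := by gcongr
      _ ≤ (L * C0 + 1) * (|μ| / (4 * (L * C0 + 1))) := by gcongr; linarith
      _ = |μ| / 4 := by field_simp
  have hT : p * (|μ| / 4) ≤ |TS φ V x (x + e)| := by
    have q1 : |p * μ| = p * |μ| := by rw [abs_mul, abs_of_pos hp']
    have q2 : p * μ = TS φ V x (x + e) - (TS φ V x (x + e) - TS φ V x x) - (TS φ V x x - p * μ) := by ring
    have q3 := abs_sub (TS φ V x (x + e) - (TS φ V x (x + e) - TS φ V x x)) (TS φ V x x - p * μ)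
    rw [← q2, q1] at q3
    have q4 := abs_sub (TS φ V x (x + e)) (TS φ V x (x + e) - TS φ V x x)
    linarith
  have hS : (a + b) * TS φ V x (x + e) = TS φ V x z - b * (TS φ V x (x + f) - TS φ V x (x + e)) := by
    have hk : ∀ k, φ (dotp (V k) z) = a * φ (dotp (V k) (x + e)) + b * φ (dotp (V k) (x + f)) :=
      fun k => congrFun heq k
    have : TS φ V x z = a * TS φ V x (x + e) + b * TS φ V x (x + f) := by
      simp only [TS, hk, Finset.mul_sum, ← Finset.sum_add_distrib]
      exact Finset.sum_congr rfl fun k _ => by ring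
    rw [this]; ring
  have hfin : |a + b| * (p * (|μ| / 4)) ≤ p * (M * η) + |b| * (p * (L * C0 * δ)) := by
    calc |a + b| * (p * (|μ| / 4)) ≤ |a + b| * |TS φ V x (x + e)| := by gcongr
      _ = |TS φ V x z - b * (TS φ V x (x + f) - TS φ V x (x + e))| := by rw [← abs_mul, hS]
      _ ≤ |TS φ V x z| + |b * (TS φ V x (x + f) - TS φ V x (x + e))| := abs_sub _ _
      _ ≤ _ := by rw [abs_mul]; gcongr
  have h5 : |a + b| * (|μ| / 4) ≤ M * η + |b| * (L * C0 * δ) := by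
    have : p * (|a + b| * (|μ| / 4)) ≤ p * (M * η + |b| * (L * C0 * δ)) := by linarith
    exact le_of_mul_le_mul_left this hp'
  have h6 : M * η + |b| * (L * C0 * δ) ≤ (L * C0 + M) * (|b| * δ + η) := by
    have := mul_nonneg hM.le (mul_nonneg (abs_nonneg b) hδ0)
    have := mul_nonneg hLC hη
    nlinarith
  rw [div_mul_eq_mul_div, div_mul_eq_mul_div, le_div_iff₀ hμ']
  linarith

set_option maxHeartbeats 4000000 in
/-- **Lemma A.9 (Near-cancellation of the two coefficients in the duplication equation).**
Under the random features setup with `n = 2` and the data, activation, and scaling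
assumptions: there are constants `c, C, ε₀ > 0` and `D` such that for all `d ≥ D`, with
probability at least `1 − 2 exp(−c log² d)` over `V` and `(x₁, x₂)`, simultaneously for all
`a₁, a₂, ε₁, ε₂` with `‖x₁+ε₁‖₂ = ‖x₁+ε₂‖₂ = √d`, `max(‖ε₁‖₂, ‖ε₂‖₂) ≤ ε₀ √d` and
`φ(x₂) = a₁ φ(x₁+ε₁) + a₂ φ(x₁+ε₂)`: `|a₁ + a₂| ≤ C (|a₂| δ + log d / √d)`. -/
theorem coefficient_near_cancellation
    (φ : ℝ → ℝ) (hφ : ActivationAssumptionCore φ)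
    (K : ℝ)
    (p : ℕ → ℕ)
    (P : (d : ℕ) → Measure (Fin d → ℝ))
    (hdata : ∀ d, DataAssumption (P d) K)
    (hp : Tendsto (fun d : ℕ => (p d : ℝ) / ((d : ℝ) * (Real.log d) ^ 2)) atTop atTop) :
    ∃ c : ℝ, 0 < c ∧ ∃ C : ℝ, 0 < C ∧ ∃ ε₀ : ℝ, 0 < ε₀ ∧ ∃ D : ℕ, ∀ d : ℕ, D ≤ d →
      1 - ENNReal.ofReal (2 * Real.exp (-c * (Real.log d) ^ 2)) ≤
        ((gaussianMatrix (p d) d).prod (Measure.pi fun _ : Fin 2 => P d))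
          {ω | ∀ a₁ a₂ : ℝ, ∀ ε₁ ε₂ : Fin d → ℝ,
            eNorm (ω.2 0 + ε₁) = Real.sqrt d → eNorm (ω.2 0 + ε₂) = Real.sqrt d →
            max (eNorm ε₁) (eNorm ε₂) ≤ ε₀ * Real.sqrt d →
            featureMap φ ω.1 (ω.2 1) =
              (fun k => a₁ * featureMap φ ω.1 (ω.2 0 + ε₁) k +
                a₂ * featureMap φ ω.1 (ω.2 0 + ε₂) k) →
            |a₁ + a₂| ≤
              C * (|a₂| * (eNorm (ε₂ - ε₁) / Real.sqrt d) +
                Real.log d / Real.sqrt d)} := by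
  obtain ⟨L, hL⟩ := hφ.lipschitz
  set μ := hermiteCoeff φ 1 with hμdef
  have hμ : μ ≠ 0 := hφ.mu1
  have hμ' : 0 < |μ| := abs_pos.2 hμ
  obtain ⟨C0, hC0, Hop⟩ := op_norm
  obtain ⟨s0, hs0, C1, hC1, Hts⟩ := two_sided hL
  set s1 := min s0 (|μ| / (4 * C1)) with hs1
  have hs1pos : 0 < s1 := lt_min hs0 (by positivity)
  have hs1a : C1 * s1 ≤ |μ| / 4 := by
    have h : s1 ≤ |μ| / (4 * C1) := min_le_right _ _
    calc C1 * s1 ≤ C1 * (|μ| / (4 * C1)) := by gcongr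
      _ = |μ| / 4 := by field_simp
  set κ := s1 * |μ| / 4 with hκ
  have hκpos : 0 < κ := by positivity
  set M1 := C1 * s0 / 2 + 2 / s0 with hM1
  have hM1pos : 0 < M1 := by positivity
  set c' := min 1 (min κ (1 / (|K| + 1) ^ 2)) with hc'
  have hc'pos : 0 < c' := by positivity
  have hc1 : c' ≤ 1 := min_le_left _ _
  have hc2 : c' ≤ κ := (min_le_right _ _).trans (min_le_left _ _)
  have hc3 : c' ≤ 1 / (|K| + 1) ^ 2 := (min_le_right _ _).trans (min_le_right _ _)
  have hlog : Tendsto (fun d : ℕ => Real.log d) atTop atTop :=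
    Real.tendsto_log_atTop.comp tendsto_natCast_atTop_atTop
  have ev1 := hlog.eventually_ge_atTop (max 1 (4 / c'))
  have ev2 := hp.eventually_ge_atTop 1
  obtain ⟨D, hD⟩ := eventually_atTop.1 ((ev1.and ev2).and (eventually_ge_atTop 1))
  refine ⟨c' / 2, by positivity, 4 / |μ| * (L * C0 + (M1 + |μ|)), by positivity,
    |μ| / (4 * (L * C0 + 1)), by positivity, D, ?_⟩
  intro d hdD
  obtain ⟨⟨hld, hpd⟩, hd1⟩ := hD d hdD
  have hd : 0 < d := hd1
  have hd' : (0 : ℝ) < d := by positivity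
  have hsd : 0 < Real.sqrt d := Real.sqrt_pos.2 hd'
  set l := Real.log d with hl
  have hl1 : 1 ≤ l := (le_max_left _ _).trans hld
  have hl4 : 4 / c' ≤ l := (le_max_right _ _).trans hld
  have hl2 : 1 ≤ l ^ 2 := one_le_pow₀ hl1
  have hpdl : (d : ℝ) * l ^ 2 ≤ p d := by
    rwa [le_div_iff₀ (by positivity), one_mul] at hpd
  have hd1' : (1 : ℝ) ≤ d := by exact_mod_cast hd1
  have hpd1 : d ≤ p d := by
    have : (d : ℝ) ≤ p d := by nlinarith
    exact_mod_cast this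
  have hpl : l ^ 2 ≤ p d := by nlinarith
  have hp0 : 0 < p d := lt_of_lt_of_le hd hpd1
  have hpr : (0 : ℝ) < p d := by positivity
  set η := l / Real.sqrt d with hη
  have hη0 : 0 < η := by positivity
  have hη2 : η ≤ 2 := by
    rw [hη, div_le_iff₀ hsd]
    have h1 := Real.log_le_sub_one_of_pos hsd
    rw [Real.log_sqrt hd'.le] at h1
    linarith
  have hηp : l ^ 2 ≤ p d * η ^ 2 := by
    rw [hη, div_pow, Real.sq_sqrt hd'.le, ← mul_div_assoc, le_div_iff₀ hd']
    nlinarith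
  have hsη : s0 * η / 2 ≤ s0 := by
    have := mul_le_mul_of_nonneg_left hη2 hs0.le
    linarith
  have hcl : c' * l ^ 2 ≤ l ^ 2 := mul_le_of_le_one_left (sq_nonneg l) hc1
  have hdat := hdata d
  have hPp := hdat.prob
  have hGp : IsProbabilityMeasure (gaussianMatrix (p d) d) := by
    unfold gaussianMatrix; infer_instance
  set G := gaussianMatrix (p d) d with hG
  set X := (Measure.pi fun _ : Fin 2 => P d) with hX
  -- the bad sets
  set q := ENNReal.ofReal (2 * Real.exp (-(c' * l ^ 2))) with hq
  set N1 : Set ((Fin (p d) → Fin d → ℝ) × (Fin 2 → Fin d → ℝ)) :=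
    Prod.fst ⁻¹' {V | ¬ ∀ u, QF V u ≤ C0 * (p d / d) * dotp u u} with hN1
  set N2 : Set ((Fin (p d) → Fin d → ℝ) × (Fin 2 → Fin d → ℝ)) :=
    Prod.snd ⁻¹' ({x | dotp (x 0) (x 0) ≠ d} ∪ {x | dotp (x 1) (x 1) ≠ d} ∪
      {x | Real.sqrt d * l < |dotp (x 0) (x 1)| ∧ dotp (x 1) (x 1) = d}) with hN2
  set N3 : Set ((Fin (p d) → Fin d → ℝ) × (Fin 2 → Fin d → ℝ)) :=
    {ω | p d * (|μ| / 2) < |TS φ ω.1 (ω.2 0) (ω.2 0) - p d * (μ * (dotp (ω.2 0) (ω.2 0) / d))| ∧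
      dotp (ω.2 0) (ω.2 0) = d} with hN3
  set N4 : Set ((Fin (p d) → Fin d → ℝ) × (Fin 2 → Fin d → ℝ)) :=
    {ω | p d * (M1 * η) < |TS φ ω.1 (ω.2 0) (ω.2 1) - p d * (μ * (dotp (ω.2 0) (ω.2 1) / d))| ∧
      (dotp (ω.2 0) (ω.2 0) = d ∧ dotp (ω.2 1) (ω.2 1) = d)} with hN4
  have hdc : ∀ i j : Fin 2, Measurable (fun ω : (Fin (p d) → Fin d → ℝ) × (Fin 2 → Fin d → ℝ) =>
      dotp (ω.2 i) (ω.2 j)) := by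
    intro i j
    refine Continuous.measurable ?_
    unfold dotp; fun_prop
  have hTc : ∀ i j : Fin 2, Measurable (fun ω : (Fin (p d) → Fin d → ℝ) × (Fin 2 → Fin d → ℝ) =>
      TS φ ω.1 (ω.2 i) (ω.2 j)) := by
    intro i j
    refine Continuous.measurable ?_
    have := hL.continuous
    unfold TS dotp; fun_prop
  have hFm : ∀ i j : Fin 2, Measurable (fun ω : (Fin (p d) → Fin d → ℝ) × (Fin 2 → Fin d → ℝ) =>
      |TS φ ω.1 (ω.2 i) (ω.2 j) - p d * (μ * (dotp (ω.2 i) (ω.2 j) / d))|) := by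
    intro i j
    have h1 := hdc i j
    have h2 := hTc i j
    exact (h2.sub (((h1.div_const _).const_mul _).const_mul _)).abs
  have hN3m : MeasurableSet N3 :=
    (measurableSet_lt measurable_const (hFm 0 0)).inter (measurableSet_eq_fun (hdc 0 0) measurable_const)
  have hN4m : MeasurableSet N4 :=
    (measurableSet_lt measurable_const (hFm 0 1)).inter
      ((measurableSet_eq_fun (hdc 0 0) measurable_const).inter
        (measurableSet_eq_fun (hdc 1 1) measurable_const))
  have b1 : (G.prod X) N1 ≤ q := by
    have e : N1 = {V | ¬ ∀ u, QF V u ≤ C0 * (p d / d) * dotp u u} ×ˢ Set.univ := by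
      rw [hN1]; ext; simp
    rw [e, Measure.prod_prod, measure_univ, mul_one]
    refine (Hop (p d) d hd hpd1).trans (ENNReal.ofReal_le_ofReal ?_)
    have : Real.exp (-(p d : ℝ)) ≤ Real.exp (-(c' * l ^ 2)) := Real.exp_le_exp.2 (by nlinarith)
    linarith [Real.exp_pos (-(c' * l ^ 2))]
  have b2 : (G.prod X) N2 ≤ q := by
    have e : N2 = Set.univ ×ˢ ({x | dotp (x 0) (x 0) ≠ d} ∪ {x | dotp (x 1) (x 1) ≠ d} ∪
      {x | Real.sqrt d * l < |dotp (x 0) (x 1)| ∧ dotp (x 1) (x 1) = d}) := by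
      rw [hN2]; ext; simp
    rw [e, Measure.prod_prod, measure_univ, one_mul]
    refine (measure_union_le _ _).trans ?_
    refine (add_le_add_left (measure_union_le _ _) _).trans ?_
    rw [hX, norm_null hdat 0, norm_null hdat 1, zero_add, zero_add]
    refine (data_bound hd hdat (by linarith : (0 : ℝ) ≤ l)).trans (ENNReal.ofReal_le_ofReal ?_)
    gcongr
    have := mul_le_mul_of_nonneg_right hc3 (sq_nonneg l)
    calc c' * l ^ 2 ≤ 1 / (|K| + 1) ^ 2 * l ^ 2 := this
      _ = _ := by ring
  have b3 : (G.prod X) N3 ≤ q := by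
    refine prod_bound G X hN3m q fun x => ?_
    by_cases hx : dotp (x 0) (x 0) = d
    · refine (measure_mono ?_).trans ((Hts (p d) d hd (x 0) (x 0) hx hx s1 hs1pos (min_le_left _ _)
        (|μ| / 2)).trans (ENNReal.ofReal_le_ofReal ?_))
      · intro V hV
        exact hV.1
      · gcongr
        have h1 : C1 * s1 ^ 2 - s1 * (|μ| / 2) ≤ -κ := by
          rw [hκ]; nlinarith
        calc p d * (C1 * s1 ^ 2 - s1 * (|μ| / 2)) ≤ p d * (-κ) := by gcongr
          _ ≤ -(c' * l ^ 2) := by nlinarith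
    · have : {V | (V, x) ∈ N3} = ∅ := by
        ext V; simp [hN3, hx]
      rw [this]; simp
  have b4 : (G.prod X) N4 ≤ q := by
    refine prod_bound G X hN4m q fun x => ?_
    by_cases hx : dotp (x 0) (x 0) = d ∧ dotp (x 1) (x 1) = d
    · refine (measure_mono ?_).trans ((Hts (p d) d hd (x 0) (x 1) hx.1 hx.2 (s0 * η / 2) (by positivity)
        hsη (M1 * η)).trans (ENNReal.ofReal_le_ofReal ?_))
      · intro V hV
        exact hV.1
      · gcongr
        have h1 : C1 * (s0 * η / 2) ^ 2 - s0 * η / 2 * (M1 * η) = -(η ^ 2) := by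
          rw [hM1]; field_simp; ring
        rw [h1]
        linarith [hηp, hcl, mul_neg (p d : ℝ) (η ^ 2)]
    · have : {V | (V, x) ∈ N4} = ∅ := by
        ext V
        simp only [hN4, Set.mem_ofPred_eq, Set.mem_empty_iff_false, iff_false]
        exact fun h => hx h.2
      rw [this]; simp
  set A := {ω : (Fin (p d) → Fin d → ℝ) × (Fin 2 → Fin d → ℝ) | ∀ a₁ a₂ : ℝ, ∀ ε₁ ε₂ : Fin d → ℝ,
            eNorm (ω.2 0 + ε₁) = Real.sqrt d → eNorm (ω.2 0 + ε₂) = Real.sqrt d →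
            max (eNorm ε₁) (eNorm ε₂) ≤ |μ| / (4 * (L * C0 + 1)) * Real.sqrt d →
            featureMap φ ω.1 (ω.2 1) =
              (fun k => a₁ * featureMap φ ω.1 (ω.2 0 + ε₁) k +
                a₂ * featureMap φ ω.1 (ω.2 0 + ε₂) k) →
            |a₁ + a₂| ≤
              (4 / |μ| * (L * C0 + (M1 + |μ|))) * (|a₂| * (eNorm (ε₂ - ε₁) / Real.sqrt d) +
                η)} with hA
  have hcover : (Set.univ : Set ((Fin (p d) → Fin d → ℝ) × (Fin 2 → Fin d → ℝ))) ⊆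
      A ∪ (N1 ∪ N2 ∪ (N3 ∪ N4)) := by
    intro ω _
    by_cases h1 : ω ∈ N1
    · exact Or.inr (Or.inl (Or.inl h1))
    by_cases h2 : ω ∈ N2
    · exact Or.inr (Or.inl (Or.inr h2))
    by_cases h3 : ω ∈ N3
    · exact Or.inr (Or.inr (Or.inl h3))
    by_cases h4 : ω ∈ N4
    · exact Or.inr (Or.inr (Or.inr h4))
    left
    have g1 : ∀ u, QF ω.1 u ≤ C0 * (p d / d) * dotp u u := by
      by_contra hc
      exact h1 hc
    have gx : dotp (ω.2 0) (ω.2 0) = d := by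
      by_contra hc
      exact h2 (Or.inl (Or.inl hc))
    have gy : dotp (ω.2 1) (ω.2 1) = d := by
      by_contra hc
      exact h2 (Or.inl (Or.inr hc))
    have gxy : |dotp (ω.2 0) (ω.2 1)| ≤ Real.sqrt d * l := by
      by_contra hc
      exact h2 (Or.inr ⟨not_le.1 hc, gy⟩)
    have g3 : |TS φ ω.1 (ω.2 0) (ω.2 0) - p d * μ| ≤ p d * (|μ| / 2) := by
      by_contra hc
      refine h3 ⟨?_, gx⟩
      rw [gx, div_self hd'.ne', mul_one]
      exact not_le.1 hc
    have g4 : |TS φ ω.1 (ω.2 0) (ω.2 1) - p d * (μ * (dotp (ω.2 0) (ω.2 1) / d))| ≤ p d * (M1 * η) := by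
      by_contra hc
      exact h4 ⟨not_le.1 hc, gx, gy⟩
    have g5 : |TS φ ω.1 (ω.2 0) (ω.2 1)| ≤ p d * ((M1 + |μ|) * η) := by
      have r1 : |dotp (ω.2 0) (ω.2 1) / d| ≤ η := by
        rw [abs_div, abs_of_pos hd', div_le_iff₀ hd', hη, div_mul_eq_mul_div, le_div_iff₀ hsd]
        calc |dotp (ω.2 0) (ω.2 1)| * Real.sqrt d ≤ (Real.sqrt d * l) * Real.sqrt d := by gcongr
          _ = l * (Real.sqrt d * Real.sqrt d) := by ring
          _ = l * d := by rw [Real.mul_self_sqrt hd'.le]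
      have r2 : |p d * (μ * (dotp (ω.2 0) (ω.2 1) / d))| ≤ p d * (|μ| * η) := by
        rw [abs_mul, abs_mul, abs_of_pos hpr]
        gcongr
      have r3 := abs_sub_abs_le_abs_sub (TS φ ω.1 (ω.2 0) (ω.2 1))
        (p d * (μ * (dotp (ω.2 0) (ω.2 1) / d)))
      nlinarith
    intro a₁ a₂ ε₁ ε₂ _ _ hmax heq
    exact deterministic hL hd hp0 hC0 hμ (by positivity) ω.1 g1 gx g3 g5 hη0.le a₁ a₂ ε₁ ε₂
      ((le_max_left _ _).trans hmax) heq
  have htot : (1 : ENNReal) ≤ (G.prod X) A + (q + q + (q + q)) := by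
    calc (1 : ENNReal) = (G.prod X) Set.univ := by simp
      _ ≤ (G.prod X) (A ∪ (N1 ∪ N2 ∪ (N3 ∪ N4))) := measure_mono hcover
      _ ≤ (G.prod X) A + (q + q + (q + q)) := by
        refine (measure_union_le _ _).trans (add_le_add le_rfl ?_)
        refine (measure_union_le _ _).trans (add_le_add ?_ ?_)
        · exact (measure_union_le _ _).trans (add_le_add b1 b2)
        · exact (measure_union_le _ _).trans (add_le_add b3 b4)
  have hqq : q + q + (q + q) ≤ ENNReal.ofReal (2 * Real.exp (-(c' / 2) * l ^ 2)) := by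
    rw [hq, ← ENNReal.ofReal_add (by positivity) (by positivity),
      ← ENNReal.ofReal_add (by positivity) (by positivity)]
    apply ENNReal.ofReal_le_ofReal
    have h1 : Real.exp (-(c' * l ^ 2)) =
        Real.exp (-(c' / 2) * l ^ 2) * Real.exp (-(c' / 2) * l ^ 2) := by
      rw [← Real.exp_add]; ring_nf
    have h2 : Real.exp (-(c' / 2) * l ^ 2) ≤ 1 / 4 := by
      have h3 : 4 ≤ c' * l := by
        rw [div_le_iff₀ hc'pos] at hl4; linarith
      have h4 : 4 ≤ c' * l ^ 2 := by nlinarith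
      have h5 : Real.exp (-(c' / 2) * l ^ 2) ≤ Real.exp (-2) := Real.exp_le_exp.2 (by nlinarith)
      refine h5.trans ?_
      have h6 : Real.exp (-2) = (Real.exp 1)⁻¹ ^ 2 := by
        rw [← Real.exp_neg, ← Real.exp_nat_mul]; norm_num
      rw [h6, inv_pow, one_div]
      have h7 := Real.exp_one_gt_d9
      exact inv_anti₀ (by norm_num) (by nlinarith)
    rw [h1]
    nlinarith [Real.exp_pos (-(c' / 2) * l ^ 2)]
  exact tsub_le_iff_right.2 (htot.trans (add_le_add le_rfl hqq))
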